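/- Consider the equation u_t = Δu + b(x,u,Du) − c(x)|u|^{σ−1}u in ℝ₊^{n+1}, where |b(x,ζ,ξ)| ≤ b₀ (1+|x|)^k log^s(2+|x|) |ζ|^μ |ξ|^α with b₀ > 0 and c(x) ≥ c₀ (1+|x|)^l log^m(2+|x|) with c₀ > 0 for all x ∈ ℝⁿ, ζ ∈ ℝ∖{0}, ξ ∈ ℝⁿ, where α > 0 and k, s, l, m are real numbers with min{l − k + α, l + 2} = 0. Define γ = m if l + 2 < l − k + α; γ = min{(m−s)/α, m} if l + 2 = l − k + α; and γ = (m−s)/α if l + 2 > l − k + α. If σ > max{1, α + μ} and γ ≥ −1, then every classical solution of the equation stabilizes to zero uniformly on every compact subset K of ℝⁿ as t → ∞, i.e. lim_{t→∞} sup_{x∈K} |u(x,t)| = 0. -/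

import Mathlib

open Set Filter MeasureTheory Metric

noncomputable section

/-- `n`-dimensional Euclidean space. -/
abbrev Eucl (n : ℕ) := EuclideanSpace ℝ (Fin n)

theorem second_deriv_nonpos_of_isLocalMax {f f' : ℝ → ℝ} {a d : ℝ}
    (hf : ∀ᶠ x in nhds a, HasDerivAt f (f' x) x) (hf' : HasDerivAt f' d a)
    (hmax : IsLocalMax f a) : d ≤ 0 := by
  by_contra! hd
  have hderiv : deriv f =ᶠ[nhds a] f' := hf.mono fun x hx => hx.deriv
  have h0 : deriv f a = 0 := hmax.deriv_eq_zero
  have h2 : deriv (deriv f) a = d := by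
    rw [hderiv.deriv_eq]; exact hf'.deriv
  have hmin : IsLocalMin f a :=
    isLocalMin_of_deriv_deriv_pos (by rw [h2]; exact hd) h0 hf.self_of_nhds.continuousAt
  have hconst : f =ᶠ[nhds a] fun _ => f a := by
    filter_upwards [hmin, hmax] with x h1 h3 using le_antisymm h3 h1
  have : deriv (deriv f) a = 0 := by
    rw [hconst.deriv.deriv_eq]; simp
  linarith

theorem nonneg_deriv_of_left_max {f : ℝ → ℝ} {a c d : ℝ} (hc : c < a)
    (hf : HasDerivAt f d a) (hmax : ∀ t, c ≤ t → t ≤ a → f t ≤ f a) : 0 ≤ d := by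
  have h := hf.hasDerivWithinAt (s := Iio a)
  rw [hasDerivWithinAt_iff_tendsto_slope' (by simp)] at h
  refine ge_of_tendsto h ?_
  filter_upwards [Ioo_mem_nhdsLT hc] with t ht
  rw [slope_def_field]
  exact div_nonneg_of_nonpos (by linarith [hmax t ht.1.le ht.2.le]) (by linarith [ht.2])

theorem norm_add_smul_single_sq {n : ℕ} (x : Eucl n) (i : Fin n) (r : ℝ) :
    ‖x + r • EuclideanSpace.single i (1 : ℝ)‖ ^ 2 = ‖x‖ ^ 2 + 2 * r * x i + r ^ 2 := by
  rw [norm_add_sq_real, norm_smul, real_inner_smul_right, EuclideanSpace.inner_single_right]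
  simp
  ring

/-- Maximum principle: a function below a radial barrier, infinite on the parabolic boundary of
`ball 0 R × (1, ∞)`, unless at some point above the barrier it has the first and second order
behaviour of the barrier at an interior maximum of the difference. -/
theorem le_radial_barrier {n : ℕ} {u : Eucl n → ℝ → ℝ} {du : Eucl n → ℝ → Eucl n}
    {d2u : Eucl n → ℝ → Fin n → Fin n → ℝ} {ut : Eucl n → ℝ → ℝ}
    (hdu : ∀ (x : Eucl n) (t : ℝ), 0 < t → ∀ i,
      HasDerivAt (fun sc : ℝ => u (x + sc • EuclideanSpace.single i (1 : ℝ)) t) (du x t i) 0)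
    (hd2u : ∀ (x : Eucl n) (t : ℝ), 0 < t → ∀ i j,
      HasDerivAt (fun sc : ℝ => du (x + sc • EuclideanSpace.single j (1 : ℝ)) t i) (d2u x t i j) 0)
    (hut : ∀ (x : Eucl n) (t : ℝ), 0 < t → HasDerivAt (fun τ : ℝ => u x τ) (ut x t) t)
    (hu_cont : ContinuousOn (fun q : Eucl n × ℝ => u q.1 q.2) (univ ×ˢ Ioi 0))
    {R : ℝ} {W W₁ W₂ G G₁ : ℝ → ℝ}
    (hW : ∀ q, 0 ≤ q → q < R ^ 2 → HasDerivAt W (W₁ q) q)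
    (hW₁ : ∀ q, 0 ≤ q → q < R ^ 2 → HasDerivAt W₁ (W₂ q) q)
    (hG : ∀ t, 1 < t → HasDerivAt G (G₁ t) t)
    (hWpos : ∀ q, 0 ≤ q → q < R ^ 2 → 0 ≤ W q)
    (hGpos : ∀ t, 1 < t → 0 ≤ G t)
    (hWtop : Tendsto W (nhdsWithin (R ^ 2) (Iio (R ^ 2))) atTop)
    (hGtop : Tendsto G (nhdsWithin 1 (Ioi 1)) atTop)
    (hstrict : ∀ x t, ‖x‖ < R → 1 < t → W (‖x‖ ^ 2) + G t < u x t →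
      du x t = (2 * W₁ (‖x‖ ^ 2)) • x →
      ∑ i, d2u x t i i ≤ 2 * n * W₁ (‖x‖ ^ 2) + 4 * ‖x‖ ^ 2 * W₂ (‖x‖ ^ 2) →
      ut x t < G₁ t)
    (x : Eucl n) (t : ℝ) (hx : ‖x‖ < R) (ht : 1 < t) :
    u x t ≤ W (‖x‖ ^ 2) + G t := by
  by_contra! hlt
  have hR : 0 < R := (norm_nonneg x).trans_lt hx
  have hcomp : ∀ ρ a : ℝ, IsCompact (closedBall (0 : Eucl n) ρ ×ˢ Icc a t) := fun ρ a =>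
    (isCompact_closedBall _ _).prod isCompact_Icc
  obtain ⟨M, hM⟩ := (hcomp R 1).bddAbove_image (f := fun q : Eucl n × ℝ => u q.1 q.2)
    (hu_cont.mono fun q hq => ⟨mem_univ _, zero_lt_one.trans_le hq.2.1⟩)
  have hM' : ∀ y τ, ‖y‖ ≤ R → 1 ≤ τ → τ ≤ t → u y τ ≤ M := fun y τ h1 h2 h3 =>
    hM ⟨(y, τ), ⟨by simpa using h1, h2, h3⟩, rfl⟩
  have hxR : ‖x‖ ^ 2 < R ^ 2 := by gcongr
  obtain ⟨Q, hQM, hQ1, hQ2⟩ :=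
    ((hWtop.eventually_gt_atTop M).and (Ioo_mem_nhdsLT hxR)).exists
  obtain ⟨a, haM, ha1, ha2⟩ :=
    ((hGtop.eventually_gt_atTop M).and (Ioo_mem_nhdsGT ht)).exists
  have hQ0 : 0 < Q := (sq_nonneg _).trans_lt hQ1
  set ρ := √Q with hρ
  have hρQ : ρ ^ 2 = Q := Real.sq_sqrt hQ0.le
  have hρR : ρ < R := by
    rw [hρ, Real.sqrt_lt' hR]; exact hQ2
  have hxρ : ‖x‖ < ρ := Real.lt_sqrt_of_sq_lt hQ1
  have hsq : ∀ y : Eucl n, ‖y‖ ≤ ρ → ‖y‖ ^ 2 < R ^ 2 := fun y hy => by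
    have := hy.trans_lt hρR
    gcongr
  have hcont : ContinuousOn (fun q : Eucl n × ℝ => u q.1 q.2 - (W (‖q.1‖ ^ 2) + G q.2))
      (closedBall (0 : Eucl n) ρ ×ˢ Icc a t) := by
    refine (hu_cont.mono fun q hq => ⟨mem_univ _, ?_⟩).sub (ContinuousOn.add ?_ ?_)
    · exact zero_lt_one.trans (ha1.trans_le hq.2.1)
    · intro q hq
      have hq' : ‖q.1‖ ≤ ρ := by simpa using hq.1
      have h1 : ContinuousAt W (‖q.1‖ ^ 2) := (hW _ (sq_nonneg _) (hsq _ hq')).continuousAt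
      have h2 : ContinuousAt (fun q : Eucl n × ℝ => ‖q.1‖ ^ 2) q := by fun_prop
      exact (ContinuousAt.comp (f := fun q : Eucl n × ℝ => ‖q.1‖ ^ 2) h1 h2).continuousWithinAt
    · intro q hq
      have h1 : ContinuousAt G q.2 := (hG _ (ha1.trans_le hq.2.1)).continuousAt
      exact (ContinuousAt.comp (f := fun q : Eucl n × ℝ => q.2) h1
        continuousAt_snd).continuousWithinAt
  obtain ⟨⟨y, τ⟩, ⟨hy, hτ⟩, hmax⟩ := (hcomp ρ a).exists_isMaxOn
    ⟨(x, t), by simpa using hxρ.le, ha2.le, le_rfl⟩ hcont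
  have hy : ‖y‖ ≤ ρ := by simpa using hy
  have hτ : τ ∈ Icc a t := hτ
  have hmax' : ∀ y' τ', ‖y'‖ ≤ ρ → a ≤ τ' → τ' ≤ t →
      u y' τ' - (W (‖y'‖ ^ 2) + G τ') ≤ u y τ - (W (‖y‖ ^ 2) + G τ) := fun y' τ' h1 h2 h3 =>
    hmax (a := (y', τ')) ⟨by simpa using h1, h2, h3⟩
  have hpos : W (‖y‖ ^ 2) + G τ < u y τ := by
    have := hmax' x t hxρ.le ha2.le le_rfl
    linarith
  have h1τ : 1 < τ := ha1.trans_le hτ.1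
  have hτ0 : 0 < τ := zero_lt_one.trans h1τ
  have huM := hM' y τ (hy.trans hρR.le) h1τ.le hτ.2
  have hyρ : ‖y‖ < ρ := by
    refine hy.lt_of_ne fun h => ?_
    rw [h, hρQ] at hpos
    linarith [hGpos τ h1τ]
  have haτ : a < τ := by
    refine hτ.1.lt_of_ne fun h => ?_
    rw [← h] at hpos huM
    linarith [hWpos _ (sq_nonneg _) (hsq y hy)]
  -- behaviour along the coordinate lines
  have hnear : ∀ i : Fin n, ∀ᶠ r : ℝ in nhds 0,
      ‖y + r • EuclideanSpace.single i (1 : ℝ)‖ < ρ := by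
    intro i
    have : ContinuousAt (fun r : ℝ => ‖y + r • EuclideanSpace.single i (1 : ℝ)‖) 0 := by fun_prop
    exact this.eventually_lt_const (by simpa using hyρ)
  have hpoly : ∀ (i : Fin n) (r : ℝ),
      HasDerivAt (fun r : ℝ => ‖y + r • EuclideanSpace.single i (1 : ℝ)‖ ^ 2)
        (2 * (y i + r)) r := by
    intro i r
    simp only [norm_add_smul_single_sq]
    have := (((hasDerivAt_id r).const_mul 2).mul_const (y i)).const_add (‖y‖ ^ 2)
    have := this.add ((hasDerivAt_id r).pow 2)
    refine this.congr_deriv ?_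
    simp; ring
  have hline : ∀ (i : Fin n) (r : ℝ), HasDerivAt
      (fun r : ℝ => u (y + r • EuclideanSpace.single i (1 : ℝ)) τ)
      (du (y + r • EuclideanSpace.single i (1 : ℝ)) τ i) r := by
    intro i r
    have h := hdu (y + r • EuclideanSpace.single i (1 : ℝ)) τ hτ0 i
    rw [← sub_self r] at h
    have := HasDerivAt.comp_sub_const r r h
    refine this.congr_of_eventuallyEq (Eventually.of_forall fun q => ?_)
    simp only [add_assoc, ← add_smul]
    congr 3; ring
  have hWline : ∀ i : Fin n, ∀ᶠ r : ℝ in nhds 0, HasDerivAt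
      (fun r : ℝ => u (y + r • EuclideanSpace.single i (1 : ℝ)) τ
        - (W (‖y + r • EuclideanSpace.single i (1 : ℝ)‖ ^ 2) + G τ))
      (du (y + r • EuclideanSpace.single i (1 : ℝ)) τ i
        - W₁ (‖y + r • EuclideanSpace.single i (1 : ℝ)‖ ^ 2) * (2 * (y i + r))) r := by
    intro i
    filter_upwards [hnear i] with r hr
    exact (hline i r).sub
      (((hW _ (sq_nonneg _) (hsq _ hr.le)).comp r (hpoly i r)).add_const (G τ))
  have hlocmax : ∀ i : Fin n, IsLocalMax
      (fun r : ℝ => u (y + r • EuclideanSpace.single i (1 : ℝ)) τ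
        - (W (‖y + r • EuclideanSpace.single i (1 : ℝ)‖ ^ 2) + G τ)) 0 := by
    intro i
    filter_upwards [hnear i] with r hr
    simpa using hmax' _ τ hr.le hτ.1 hτ.2
  have hgrad : du y τ = (2 * W₁ (‖y‖ ^ 2)) • y := by
    ext i
    have := (hlocmax i).hasDerivAt_eq_zero (hWline i).self_of_nhds
    simp at this
    simp
    linarith
  have hsecond : ∀ i : Fin n,
      d2u y τ i i ≤ 2 * W₁ (‖y‖ ^ 2) + 4 * (y i) ^ 2 * W₂ (‖y‖ ^ 2) := by
    intro i
    have h0 : ‖y + (0 : ℝ) • EuclideanSpace.single i (1 : ℝ)‖ ^ 2 = ‖y‖ ^ 2 := by simp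
    have hd := hW₁ _ (sq_nonneg _) (hsq y hy)
    rw [← h0] at hd
    have hd' := hd.comp (0 : ℝ) (hpoly i 0)
    have hl : HasDerivAt (fun r : ℝ => 2 * (y i + r)) 2 0 := by
      simpa using ((hasDerivAt_id (0 : ℝ)).const_add (y i)).const_mul 2
    have := second_deriv_nonpos_of_isLocalMax (hWline i)
      ((hd2u y τ hτ0 i i).sub (hd'.mul hl)) (hlocmax i)
    simp at this
    nlinarith [this]
  have hlap : ∑ i, d2u y τ i i ≤ 2 * n * W₁ (‖y‖ ^ 2) + 4 * ‖y‖ ^ 2 * W₂ (‖y‖ ^ 2) := by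
    refine (Finset.sum_le_sum fun i _ => hsecond i).trans (le_of_eq ?_)
    rw [Finset.sum_add_distrib, EuclideanSpace.real_norm_sq_eq, Finset.mul_sum, Finset.sum_mul]
    simp
    ring
  have htime := nonneg_deriv_of_left_max haτ
    ((hut y τ hτ0).sub ((hG τ h1τ).const_add (W (‖y‖ ^ 2))))
    (fun r h1 h2 => hmax' y r hy h1 (h2.trans hτ.2))
  linarith [hstrict y τ (hyρ.trans hρR) h1τ hpos hgrad hlap]

/-- If `S⁻ᵝ ≤ w` and `ε ≤ w`, then a power `S⁻ᵃ` with `a ≤ pβ` is dominated by `w ^ p`. -/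
theorem rpow_neg_le_mul_rpow {S β w ε a p : ℝ} (hS : 0 < S) (hβ : 0 < β) (hε : 0 < ε)
    (hSw : S ^ (-β) ≤ w) (hεw : ε ≤ w) (ha : 0 ≤ a) (hap : a ≤ p * β) :
    S ^ (-a) ≤ ε ^ (a / β - p) * w ^ p := by
  have hw : 0 < w := hε.trans_le hεw
  calc S ^ (-a) = (S ^ (-β)) ^ (a / β) := by
        rw [← Real.rpow_mul hS.le]; congr 1; field_simp
    _ ≤ w ^ (a / β) := by gcongr
    _ = w ^ (a / β - p) * w ^ p := by rw [← Real.rpow_add hw]; congr 1; ring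
    _ ≤ ε ^ (a / β - p) * w ^ p := by
        gcongr ?_ * _
        refine Real.rpow_le_rpow_of_nonpos hε hεw ?_
        rw [sub_nonpos, div_le_iff₀ hβ]; exact hap

theorem exists_pos_le_rpow_mul_log_rpow {a b : ℝ} (ha : 0 ≤ a) (hab : a = 0 → 0 ≤ b) :
    ∃ κ : ℝ, 0 < κ ∧ ∀ r : ℝ, 0 ≤ r → κ ≤ (1 + r) ^ a * Real.log (2 + r) ^ b := by
  have hlog2 : 0 < Real.log 2 := Real.log_pos (by norm_num)
  have hlog : ∀ r : ℝ, 0 ≤ r → Real.log 2 ≤ Real.log (2 + r) := fun r hr =>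
    Real.log_le_log (by norm_num) (by linarith)
  rcases le_or_gt 0 b with hb | hb
  · refine ⟨Real.log 2 ^ b, by positivity, fun r hr => ?_⟩
    have h1 : 1 ≤ (1 + r) ^ a := Real.one_le_rpow (by linarith) ha
    have h2 : Real.log 2 ^ b ≤ Real.log (2 + r) ^ b := 
      Real.rpow_le_rpow hlog2.le (hlog r hr) hb
    have h3 : 0 < Real.log 2 ^ b := by positivity
    nlinarith
  · have ha' : 0 < a := ha.lt_of_ne fun h => by linarith [hab h.symm]
    set e := a / (-b) with he
    have hepos : 0 < e := div_pos ha' (by linarith)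
    refine ⟨(2 ^ e / e) ^ b, by positivity, fun r hr => ?_⟩
    have hX : 0 < 1 + r := by linarith
    have h1 : Real.log (2 + r) ≤ 2 ^ e / e * (1 + r) ^ e := by
      refine (Real.log_le_rpow_div (by linarith) hepos).trans ?_
      rw [div_mul_eq_mul_div, ← Real.mul_rpow (by norm_num) hX.le]
      gcongr
      linarith
    have h2 : (2 ^ e / e * (1 + r) ^ e) ^ b ≤ Real.log (2 + r) ^ b :=
      Real.rpow_le_rpow_of_nonpos (hlog2.trans_le (hlog r hr)) h1 hb.le
    rw [Real.mul_rpow (by positivity) (by positivity), ← Real.rpow_mul hX.le] at h2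
    have h3 : e * b = -a := by
      have := hb.ne
      rw [he]
      field_simp
    rw [h3] at h2
    calc (2 ^ e / e) ^ b = (1 + r) ^ a * ((2 ^ e / e) ^ b * (1 + r) ^ (-a)) := by
          rw [Real.rpow_neg hX.le]; field_simp
      _ ≤ _ := by gcongr

theorem one_le_log_three_add {q : ℝ} (hq : 0 ≤ q) : 1 ≤ Real.log (3 + q) := by
  rw [Real.le_log_iff_exp_le (by linarith)]
  linarith [Real.exp_one_lt_three]

/-- The argument of the negative power in the spatial barrier. -/
def barrierArg (lam Z q : ℝ) : ℝ := lam * (Z - Real.log (Real.log (3 + q)))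

theorem hasDerivAt_barrierArg (lam Z : ℝ) {q : ℝ} (hq : 0 ≤ q) :
    HasDerivAt (barrierArg lam Z) (-lam / ((3 + q) * Real.log (3 + q))) q := by
  have hl := one_le_log_three_add hq
  have h0 : HasDerivAt (fun q : ℝ => 3 + q) 1 q := (hasDerivAt_id q).const_add 3
  have h1 := ((h0.log (by linarith)).log (by linarith)).const_sub Z |>.const_mul lam
  refine h1.congr_deriv ?_
  field_simp

theorem barrierArg_pos {lam Q q : ℝ} (hlam : 0 < lam) (hq : 0 ≤ q) (hqQ : q < Q) :
    0 < barrierArg lam (Real.log (Real.log (3 + Q))) q := by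
  have hl := one_le_log_three_add hq
  refine mul_pos hlam (sub_pos.2 ?_)
  exact Real.log_lt_log (by linarith) (Real.log_lt_log (by linarith) (by linarith))

theorem hasDerivAt_barrier (ε β lam Z : ℝ) {q : ℝ} (hq : 0 ≤ q) (hS : 0 < barrierArg lam Z q) :
    HasDerivAt (fun q => ε + barrierArg lam Z q ^ (-β))
      (β * lam * barrierArg lam Z q ^ (-(β + 1)) / ((3 + q) * Real.log (3 + q))) q := by
  have h := ((hasDerivAt_barrierArg lam Z hq).rpow_const (p := -β) (Or.inl hS.ne')).const_add ε
  refine h.congr_deriv ?_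
  rw [show -β - 1 = -(β + 1) by ring]
  ring

theorem hasDerivAt_barrier_deriv (β lam Z : ℝ) {q : ℝ} (hq : 0 ≤ q)
    (hS : 0 < barrierArg lam Z q) :
    HasDerivAt
      (fun q => β * lam * barrierArg lam Z q ^ (-(β + 1)) / ((3 + q) * Real.log (3 + q)))
      (β * (β + 1) * lam ^ 2 * barrierArg lam Z q ^ (-(β + 2)) / ((3 + q) * Real.log (3 + q)) ^ 2
        - β * lam * barrierArg lam Z q ^ (-(β + 1)) * (Real.log (3 + q) + 1)
          / ((3 + q) * Real.log (3 + q)) ^ 2) q := by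
  have hl := one_le_log_three_add hq
  have h0 : HasDerivAt (fun q : ℝ => 3 + q) 1 q := (hasDerivAt_id q).const_add 3
  have hy : HasDerivAt (fun q : ℝ => (3 + q) * Real.log (3 + q)) (Real.log (3 + q) + 1) q := by
    refine (h0.mul (h0.log (by linarith))).congr_deriv ?_
    field_simp
  have h := (((hasDerivAt_barrierArg lam Z hq).rpow_const (p := -(β + 1))
    (Or.inl hS.ne')).const_mul (β * lam)).div hy (by positivity)
  refine h.congr_deriv ?_
  rw [show -(β + 1) - 1 = -(β + 2) by ring]
  have : 0 < 3 + q := by linarith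
  have : 0 < Real.log (3 + q) := by linarith
  field_simp

theorem tendsto_rpow_neg_atTop_of_tendsto_zero {f : ℝ → ℝ} {F : Filter ℝ} {β : ℝ} (hβ : 0 < β)
    (hf : Tendsto f F (nhds 0)) (hpos : ∀ᶠ x in F, 0 < f x) :
    Tendsto (fun x => f x ^ (-β)) F atTop := by
  have h : Tendsto f F (nhdsWithin 0 (Ioi 0)) := tendsto_nhdsWithin_iff.2 ⟨hf, hpos⟩
  have := (tendsto_rpow_atTop hβ).comp (tendsto_inv_nhdsGT_zero.comp h)
  refine this.congr' ?_
  filter_upwards [hpos] with x hx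
  simp [Real.rpow_neg hx.le, Real.inv_rpow hx.le]

theorem tendsto_barrier_atTop {ε β lam Q : ℝ} (hβ : 0 < β) (hlam : 0 < lam) (hQ : 0 < Q) :
    Tendsto (fun q => ε + barrierArg lam (Real.log (Real.log (3 + Q))) q ^ (-β))
      (nhdsWithin Q (Iio Q)) atTop := by
  refine tendsto_atTop_add_const_left _ ε (tendsto_rpow_neg_atTop_of_tendsto_zero hβ ?_ ?_)
  · have := (hasDerivAt_barrierArg lam (Real.log (Real.log (3 + Q))) hQ.le).continuousAt.tendsto
    have h0 : barrierArg lam (Real.log (Real.log (3 + Q))) Q = 0 := by simp [barrierArg]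
    rw [h0] at this
    exact this.mono_left nhdsWithin_le_nhds
  · filter_upwards [Ioo_mem_nhdsLT hQ] with q hq using barrierArg_pos hlam hq.1.le hq.2

theorem barrier_laplacian_le {n : ℕ} {r β lam K₁ K₂ κ V A A' : ℝ} (hr : 0 ≤ r)
    (hβ : 0 < β) (hlam : 0 < lam) (hlam1 : lam ≤ 1) (hV : 0 ≤ V) (hA : 0 ≤ A) (hA' : 0 ≤ A')
    (hAV : A ≤ K₁ * V) (hAV' : A' ≤ K₂ * V)
    (hsmall : lam * (2 * (2 * n * β * K₁ + 4 * β * (β + 1) * K₂)) ≤ κ / 4) :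
    2 * n * (β * lam * A / ((3 + r ^ 2) * Real.log (3 + r ^ 2)))
      + 4 * r ^ 2 * (β * (β + 1) * lam ^ 2 * A' / ((3 + r ^ 2) * Real.log (3 + r ^ 2)) ^ 2
        - β * lam * A * (Real.log (3 + r ^ 2) + 1)
          / ((3 + r ^ 2) * Real.log (3 + r ^ 2)) ^ 2)
      ≤ κ / ((1 + r) ^ 2 * Real.log (2 + r)) / 4 * V := by
  have hl := one_le_log_three_add (sq_nonneg r)
  have hΛ : 0 < Real.log (2 + r) := Real.log_pos (by linarith)
  have hlΛ : Real.log (2 + r) ≤ Real.log (3 + r ^ 2) :=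
    Real.log_le_log (by linarith) (by nlinarith [sq_nonneg (r - 1)])
  have hyX : (1 + r) ^ 2 ≤ 2 * (3 + r ^ 2) := by nlinarith [sq_nonneg (r - 1)]
  set ℓ := Real.log (3 + r ^ 2)
  set Λ := Real.log (2 + r)
  set y := 3 + r ^ 2 with hy
  have hy0 : 0 < y := by positivity
  have hX : 0 < 1 + r := by linarith
  have h1 : 4 * r ^ 2 * (β * (β + 1) * lam ^ 2 * A' / (y * ℓ) ^ 2) ≤
      4 * β * (β + 1) * lam * A' / (y * ℓ) := by
    have : 4 * r ^ 2 * (β * (β + 1) * lam ^ 2 * A' / (y * ℓ) ^ 2) =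
      (4 * β * (β + 1) * lam * A' / (y * ℓ)) * ((r ^ 2 / (y * ℓ)) * lam) := by
      field_simp
    rw [this]
    refine mul_le_of_le_one_right (by positivity) (mul_le_one₀ ?_ hlam.le hlam1)
    rw [div_le_one (by positivity)]
    nlinarith
  have h2 : 0 ≤ 4 * r ^ 2 * (β * lam * A * (ℓ + 1) / (y * ℓ) ^ 2) := by positivity
  have h3 : 1 / (y * ℓ) ≤ 2 / ((1 + r) ^ 2 * Λ) := by
    rw [div_le_div_iff₀ (by positivity) (by positivity)]
    calc 1 * ((1 + r) ^ 2 * Λ) ≤ (2 * y) * ℓ := by rw [one_mul]; gcongr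
      _ = _ := by ring
  have hKV₁ := hA.trans hAV
  have hKV₂ := hA'.trans hAV'
  calc _ ≤ 2 * n * (β * lam * A / (y * ℓ)) + 4 * β * (β + 1) * lam * A' / (y * ℓ) := by
        rw [mul_sub]; linarith
    _ = lam * (2 * n * β * A + 4 * β * (β + 1) * A') * (1 / (y * ℓ)) := by ring
    _ ≤ lam * (2 * n * β * (K₁ * V) + 4 * β * (β + 1) * (K₂ * V))
        * (2 / ((1 + r) ^ 2 * Λ)) := by gcongr
    _ = lam * (2 * (2 * n * β * K₁ + 4 * β * (β + 1) * K₂)) * (V / ((1 + r) ^ 2 * Λ)) := by ring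
    _ ≤ κ / 4 * (V / ((1 + r) ^ 2 * Λ)) := by gcongr
    _ = _ := by ring

theorem barrier_gradient_le {r β lam K κ V A : ℝ} (hr : 0 ≤ r)
    (hβ : 0 < β) (hlam : 0 < lam) (hV : 0 ≤ V) (hA : 0 ≤ A) (hAV : A ≤ K * V)
    (hsmall : lam * (4 * β * K) ≤ κ) :
    2 * (β * lam * A / ((3 + r ^ 2) * Real.log (3 + r ^ 2))) * r
      ≤ κ / ((1 + r) * Real.log (2 + r)) * V := by
  have hl := one_le_log_three_add (sq_nonneg r)
  have hΛ : 0 < Real.log (2 + r) := Real.log_pos (by linarith)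
  have hlΛ : Real.log (2 + r) ≤ Real.log (3 + r ^ 2) :=
    Real.log_le_log (by linarith) (by nlinarith [sq_nonneg (r - 1)])
  have hyX : r * (1 + r) ≤ 2 * (3 + r ^ 2) := by nlinarith [sq_nonneg (r - 1)]
  set ℓ := Real.log (3 + r ^ 2)
  set Λ := Real.log (2 + r)
  set y := 3 + r ^ 2 with hy
  have hy0 : 0 < y := by positivity
  have hX : 0 < 1 + r := by linarith
  have h3 : r / (y * ℓ) ≤ 2 / ((1 + r) * Λ) := by
    rw [div_le_div_iff₀ (by positivity) (by positivity)]
    calc r * ((1 + r) * Λ) = (r * (1 + r)) * Λ := by ring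
      _ ≤ (2 * y) * ℓ := by gcongr
      _ = _ := by ring
  have hKV := hA.trans hAV
  calc _ = 2 * β * lam * A * (r / (y * ℓ)) := by ring
    _ ≤ 2 * β * lam * (K * V) * (2 / ((1 + r) * Λ)) := by gcongr
    _ = lam * (4 * β * K) * (V / ((1 + r) * Λ)) := by ring
    _ ≤ κ * (V / ((1 + r) * Λ)) := by gcongr
    _ = _ := by ring

theorem tendsto_barrierArg_rpow_neg_zero {β lam a : ℝ} (hβ : 0 < β) (hlam : 0 < lam) :
    Tendsto (fun R : ℝ => barrierArg lam (Real.log (Real.log (3 + R ^ 2))) a ^ (-β))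
      atTop (nhds 0) := by
  refine (tendsto_rpow_neg_atTop hβ).comp ?_
  unfold barrierArg
  refine Tendsto.const_mul_atTop hlam ?_
  refine tendsto_atTop_add_const_right _ _ ?_
  refine Real.tendsto_log_atTop.comp (Real.tendsto_log_atTop.comp ?_)
  exact tendsto_atTop_add_const_left _ _ (tendsto_pow_atTop two_ne_zero)

theorem exists_barrier_exponent {σ τ : ℝ} (hσ : 1 < σ) (hτ : 1 < τ) :
    ∃ β : ℝ, 0 < β ∧ β + 2 ≤ σ * β ∧ β + 1 ≤ τ * β := by
  have h1 : 0 < σ - 1 := by linarith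
  have h2 : 0 < τ - 1 := by linarith
  refine ⟨2 / (σ - 1) + 1 / (τ - 1), by positivity, ?_, ?_⟩
  · have : (2 / (σ - 1) + 1 / (τ - 1)) * (σ - 1) = 2 + 1 / (τ - 1) * (σ - 1) := by field_simp
    have : 0 ≤ 1 / (τ - 1) * (σ - 1) := by positivity
    linarith
  · have : (2 / (σ - 1) + 1 / (τ - 1)) * (τ - 1) = 2 / (σ - 1) * (τ - 1) + 1 := by field_simp
    have : 0 ≤ 2 / (σ - 1) * (τ - 1) := by positivity
    linarith

/-- One-sided decay: where a solution is positive, it is eventually below any level, uniformly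
on balls, if the absorption dominates the gradient term with critical logarithmic weights. -/
theorem eventually_forall_le_of_subsolution {n : ℕ} {u : Eucl n → ℝ → ℝ} {du : Eucl n → ℝ → Eucl n}
    {d2u : Eucl n → ℝ → Fin n → Fin n → ℝ} {ut : Eucl n → ℝ → ℝ} {B C : ℝ → ℝ}
    {α μ σ κ κ' : ℝ} (hα : 0 < α) (hσ : max 1 (α + μ) < σ) (hκ : 0 < κ) (hκ' : 0 < κ')
    (hB : ∀ r, 0 ≤ r → 0 ≤ B r)
    (hC : ∀ r, 0 ≤ r → κ / ((1 + r) ^ 2 * Real.log (2 + r)) ≤ C r)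
    (hBC : ∀ r, 0 ≤ r → B r * (κ' / ((1 + r) * Real.log (2 + r))) ^ α ≤ C r / 2)
    (hdu : ∀ (x : Eucl n) (t : ℝ), 0 < t → ∀ i,
      HasDerivAt (fun sc : ℝ => u (x + sc • EuclideanSpace.single i (1 : ℝ)) t) (du x t i) 0)
    (hd2u : ∀ (x : Eucl n) (t : ℝ), 0 < t → ∀ i j,
      HasDerivAt (fun sc : ℝ => du (x + sc • EuclideanSpace.single j (1 : ℝ)) t i) (d2u x t i j) 0)
    (hut : ∀ (x : Eucl n) (t : ℝ), 0 < t → HasDerivAt (fun τ : ℝ => u x τ) (ut x t) t)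
    (hu_cont : ContinuousOn (fun q : Eucl n × ℝ => u q.1 q.2) (univ ×ˢ Ioi 0))
    (hsub : ∀ (x : Eucl n) (t : ℝ), 0 < t → 0 < u x t →
      ut x t ≤ (∑ i, d2u x t i i) + B ‖x‖ * u x t ^ μ * ‖du x t‖ ^ α - C ‖x‖ * u x t ^ σ)
    {ε ρ : ℝ} (hε : 0 < ε) :
    ∀ᶠ t in atTop, ∀ x, ‖x‖ ≤ ρ → u x t ≤ 3 * ε := by
  have hσ1 : 1 < σ := (le_max_left _ _).trans_lt hσ
  have hσ2 : α + μ < σ := (le_max_right _ _).trans_lt hσ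
  set p := (σ - μ) / α with hp
  have hp1 : 1 < p := by rw [hp, lt_div_iff₀ hα]; linarith
  have hpα : p * α = σ - μ := by rw [hp]; field_simp
  obtain ⟨β, hβ, hβσ, hβp⟩ := exists_barrier_exponent hσ1 hp1
  set K₁ := ε ^ ((β + 1) / β - σ) with hK₁
  set K₂ := ε ^ ((β + 2) / β - σ) with hK₂
  set K₃ := ε ^ ((β + 1) / β - p) with hK₃
  have hK₁0 : 0 < K₁ := by positivity
  have hK₂0 : 0 < K₂ := by positivity
  have hK₃0 : 0 < K₃ := by positivity
  obtain ⟨lam, hlam, hlam1, hlam2, hlam3⟩ : ∃ lam : ℝ, 0 < lam ∧ lam ≤ 1 ∧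
      lam * (2 * (2 * n * β * K₁ + 4 * β * (β + 1) * K₂)) ≤ κ / 4 ∧
      lam * (4 * β * K₃) ≤ κ' := by
    refine ⟨min 1 (min (κ / 4 / (2 * (2 * n * β * K₁ + 4 * β * (β + 1) * K₂)))
      (κ' / (4 * β * K₃))), by positivity, min_le_left _ _, ?_, ?_⟩
    · rw [← le_div_iff₀ (by positivity)]
      exact (min_le_right _ _).trans (min_le_left _ _)
    · rw [← le_div_iff₀ (by positivity)]
      exact (min_le_right _ _).trans (min_le_right _ _)
  obtain ⟨R, hRε, hRρ, hR0⟩ := (((tendsto_barrierArg_rpow_neg_zero (a := ρ ^ 2) hβ hlam).eventually_le_const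
    hε).and ((eventually_gt_atTop |ρ|).and (eventually_gt_atTop 0))).exists
  set Z := Real.log (Real.log (3 + R ^ 2)) with hZ
  have hΛR : 0 < Real.log (2 + R) := Real.log_pos (by linarith)
  set κR := κ / ((1 + R) ^ 2 * Real.log (2 + R)) with hκR
  have hκR0 : 0 < κR := by positivity
  set η := κR / 8 / (β * K₁) with hη
  have hη0 : 0 < η := by positivity
  have hηK : η * (β * K₁) = κR / 8 := by rw [hη]; field_simp
  have hS : ∀ q, 0 ≤ q → q < R ^ 2 → 0 < barrierArg lam Z q := fun q h1 h2 =>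
    barrierArg_pos hlam h1 h2
  have hGder : ∀ t : ℝ, 1 < t → HasDerivAt (fun t => (η * (t - 1)) ^ (-β))
      (-(η * β * (η * (t - 1)) ^ (-(β + 1)))) t := by
    intro t ht
    have h0 : HasDerivAt (fun t : ℝ => η * (t - 1)) η t := by
      simpa using ((hasDerivAt_id t).sub_const 1).const_mul η
    have : 0 < t - 1 := by linarith
    refine (h0.rpow_const (p := -β) (Or.inl (by positivity))).congr_deriv ?_
    rw [show -β - 1 = -(β + 1) by ring]
    ring
  have hbar := le_radial_barrier hdu hd2u hut hu_cont (R := R)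
    (W := fun q => ε + barrierArg lam Z q ^ (-β))
    (G := fun t => (η * (t - 1)) ^ (-β))
    (fun q h1 h2 => hasDerivAt_barrier ε β lam Z h1 (hS q h1 h2))
    (fun q h1 h2 => hasDerivAt_barrier_deriv β lam Z h1 (hS q h1 h2))
    hGder
    (fun q h1 h2 => by have := hS q h1 h2; positivity)
    (fun t ht => by have : 0 < t - 1 := by linarith
                    positivity)
    (tendsto_barrier_atTop hβ hlam (by positivity))
    (by
      refine tendsto_rpow_neg_atTop_of_tendsto_zero hβ ?_ ?_
      · have : Continuous fun t : ℝ => η * (t - 1) := by fun_prop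
        have h := this.tendsto 1
        simp only [sub_self, mul_zero] at h
        exact h.mono_left nhdsWithin_le_nhds
      · filter_upwards [self_mem_nhdsWithin] with t ht
        exact mul_pos hη0 (sub_pos.2 ht))
    (by
      intro x t hx ht hlt hgrad hlap
      have hr := norm_nonneg x
      have hrR : ‖x‖ ^ 2 < R ^ 2 := by gcongr
      have hSx := hS _ (sq_nonneg _) hrR
      have hT : 0 < η * (t - 1) := mul_pos hη0 (by linarith)
      set S := barrierArg lam Z (‖x‖ ^ 2)
      set v := u x t
      have hSβ : 0 < S ^ (-β) := by positivity
      have hTβ : 0 < (η * (t - 1)) ^ (-β) := by positivity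
      have hεv : ε ≤ v := by linarith
      have hv : 0 < v := hε.trans_le hεv
      have e1 : S ^ (-(β + 1)) ≤ K₁ * v ^ σ := rpow_neg_le_mul_rpow hSx hβ hε (by linarith) hεv
        (by linarith) (by linarith)
      have e2 : S ^ (-(β + 2)) ≤ K₂ * v ^ σ := rpow_neg_le_mul_rpow hSx hβ hε (by linarith) hεv
        (by linarith) hβσ
      have e3 : S ^ (-(β + 1)) ≤ K₃ * v ^ p := rpow_neg_le_mul_rpow hSx hβ hε (by linarith) hεv
        (by linarith) hβp
      have e4 : (η * (t - 1)) ^ (-(β + 1)) ≤ K₁ * v ^ σ :=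
        rpow_neg_le_mul_rpow hT hβ hε (by linarith) hεv (by linarith) (by linarith)
      have hvσ : 0 < v ^ σ := by positivity
      have hΛ : 0 < Real.log (2 + ‖x‖) := Real.log_pos (by linarith)
      have hlap' := hlap.trans (barrier_laplacian_le hr hβ hlam hlam1 hvσ.le (by positivity)
        (by positivity) e1 e2 hlam2)
      have hCx := hC _ hr
      have hκRx : κR ≤ κ / ((1 + ‖x‖) ^ 2 * Real.log (2 + ‖x‖)) := by
        rw [hκR]; gcongr
      have hgr : ‖du x t‖ ≤ κ' / ((1 + ‖x‖) * Real.log (2 + ‖x‖)) * v ^ p := by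
        refine le_trans (le_of_eq ?_) (barrier_gradient_le hr hβ hlam (by positivity)
          (by positivity) e3 hlam3)
        have hl := one_le_log_three_add (sq_nonneg ‖x‖)
        rw [hgrad, norm_smul, Real.norm_of_nonneg (by positivity)]
      have hgr' : B ‖x‖ * v ^ μ * ‖du x t‖ ^ α ≤ C ‖x‖ / 2 * v ^ σ := by
        have hBx := hB _ hr
        calc B ‖x‖ * v ^ μ * ‖du x t‖ ^ α
            ≤ B ‖x‖ * v ^ μ * (κ' / ((1 + ‖x‖) * Real.log (2 + ‖x‖)) * v ^ p) ^ α := by gcongr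
          _ = B ‖x‖ * (κ' / ((1 + ‖x‖) * Real.log (2 + ‖x‖))) ^ α * (v ^ μ * v ^ (σ - μ)) := by
              rw [Real.mul_rpow (by positivity) (by positivity), ← Real.rpow_mul hv.le, hpα]
              ring
          _ = B ‖x‖ * (κ' / ((1 + ‖x‖) * Real.log (2 + ‖x‖))) ^ α * v ^ σ := by
              rw [← Real.rpow_add hv]; congr 2; ring
          _ ≤ _ := by gcongr; exact hBC _ hr
      have hmain := hsub x t (by linarith) hv
      have htime : η * β * (η * (t - 1)) ^ (-(β + 1)) ≤ C ‖x‖ / 8 * v ^ σ := by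
        calc η * β * (η * (t - 1)) ^ (-(β + 1)) ≤ η * β * (K₁ * v ^ σ) := by gcongr
          _ = κR / 8 * v ^ σ := by rw [← hηK]; ring
          _ ≤ _ := by gcongr; exact hκRx.trans hCx
      have hCpos : 0 < C ‖x‖ * v ^ σ :=
        mul_pos (hκR0.trans_le (hκRx.trans hCx)) hvσ
      have hlap'' : ∑ i, d2u x t i i ≤ C ‖x‖ / 4 * v ^ σ := hlap'.trans (by gcongr)
      linarith)
  have hGlim : Tendsto (fun t : ℝ => (η * (t - 1)) ^ (-β)) atTop (nhds 0) :=
    (tendsto_rpow_neg_atTop hβ).comp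
      (Tendsto.const_mul_atTop hη0 (tendsto_atTop_add_const_right _ _ tendsto_id))
  filter_upwards [hGlim.eventually_le_const hε, eventually_gt_atTop 1] with t htG ht x hx
  have hxR : ‖x‖ < R := (hx.trans (le_abs_self ρ)).trans_lt hRρ
  have hρ2 : ρ ^ 2 < R ^ 2 := by rw [← sq_abs ρ]; gcongr
  have hmono : barrierArg lam Z (ρ ^ 2) ≤ barrierArg lam Z (‖x‖ ^ 2) := by
    have hl := one_le_log_three_add (sq_nonneg ‖x‖)
    unfold barrierArg
    gcongr
  have hle : barrierArg lam Z (‖x‖ ^ 2) ^ (-β) ≤ barrierArg lam Z (ρ ^ 2) ^ (-β) :=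
    Real.rpow_le_rpow_of_nonpos (hS _ (sq_nonneg _) hρ2) hmono (by linarith)
  have := hbar x t hxR ht
  linarith

/-- The critical exponents make the absorption dominate `1 / (r² log r)`, and its ratio to the
gradient coefficient dominate `(1 / (r log r)) ^ α`. -/
theorem exists_critical_coefficient_bounds {b₀ c₀ α k s l m γ : ℝ}
    (hb₀ : 0 < b₀) (hc₀ : 0 < c₀) (hα : 0 < α)
    (hcrit : min (l - k + α) (l + 2) = 0)
    (hγ₁ : l + 2 < l - k + α → γ = m)
    (hγ₂ : l + 2 = l - k + α → γ = min ((m - s) / α) m)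
    (hγ₃ : l - k + α < l + 2 → γ = (m - s) / α)
    (hγ : -1 ≤ γ) :
    ∃ κ κ' : ℝ, 0 < κ ∧ 0 < κ' ∧
      (∀ r : ℝ, 0 ≤ r → κ / ((1 + r) ^ 2 * Real.log (2 + r)) ≤
        c₀ * (1 + r) ^ l * Real.log (2 + r) ^ m) ∧
      (∀ r : ℝ, 0 ≤ r → b₀ * (1 + r) ^ k * Real.log (2 + r) ^ s *
        (κ' / ((1 + r) * Real.log (2 + r))) ^ α ≤
        c₀ * (1 + r) ^ l * Real.log (2 + r) ^ m / 2) := by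
  have h1 : 0 ≤ l - k + α := hcrit ▸ min_le_left _ _
  have h2 : 0 ≤ l + 2 := hcrit ▸ min_le_right _ _
  have h3 : l + 2 = 0 → 0 ≤ m + 1 := by
    intro h
    rcases (h ▸ h1 : l + 2 ≤ l - k + α).lt_or_eq with h' | h'
    · linarith [hγ₁ h']
    · have := min_le_right ((m - s) / α) m
      linarith [hγ₂ h']
  have h4 : l - k + α = 0 → 0 ≤ m - s + α := by
    intro h
    have : -1 ≤ (m - s) / α := by
      rcases (h ▸ h2 : l - k + α ≤ l + 2).lt_or_eq with h' | h'
      · linarith [hγ₃ h']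
      · have := min_le_left ((m - s) / α) m
        linarith [hγ₂ h'.symm]
    rw [le_div_iff₀ hα] at this
    linarith
  obtain ⟨κ, hκ, hκle⟩ := exists_pos_le_rpow_mul_log_rpow h2 h3
  obtain ⟨δ, hδ, hδle⟩ := exists_pos_le_rpow_mul_log_rpow h1 h4
  refine ⟨c₀ * κ, (c₀ * δ / (2 * b₀)) ^ (1 / α), by positivity, by positivity,
    fun r hr => ?_, fun r hr => ?_⟩
  · have hX : 0 < 1 + r := by linarith
    have hΛ : 0 < Real.log (2 + r) := Real.log_pos (by linarith)
    rw [div_le_iff₀ (by positivity)]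
    have := hκle r hr
    rw [Real.rpow_add hX, Real.rpow_add hΛ, Real.rpow_two, Real.rpow_one] at this
    calc c₀ * κ ≤ c₀ * ((1 + r) ^ l * (1 + r) ^ 2 * (Real.log (2 + r) ^ m * Real.log (2 + r))) := by
          gcongr
      _ = _ := by ring
  · have hX : 0 < 1 + r := by linarith
    have hΛ : 0 < Real.log (2 + r) := Real.log_pos (by linarith)
    have := hδle r hr
    rw [Real.rpow_add hX, Real.rpow_add hΛ, Real.rpow_sub hX, Real.rpow_sub hΛ] at this
    rw [Real.div_rpow (by positivity) (by positivity), ← Real.rpow_mul (by positivity),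
      one_div_mul_cancel hα.ne', Real.rpow_one, Real.mul_rpow hX.le hΛ.le]
    calc b₀ * (1 + r) ^ k * Real.log (2 + r) ^ s *
          (c₀ * δ / (2 * b₀) / ((1 + r) ^ α * Real.log (2 + r) ^ α))
        = c₀ / 2 * (1 + r) ^ k * Real.log (2 + r) ^ s * δ
          / ((1 + r) ^ α * Real.log (2 + r) ^ α) := by field_simp
      _ ≤ c₀ / 2 * (1 + r) ^ k * Real.log (2 + r) ^ s *
          ((1 + r) ^ l / (1 + r) ^ k * (1 + r) ^ α *
            (Real.log (2 + r) ^ m / Real.log (2 + r) ^ s * Real.log (2 + r) ^ α))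
          / ((1 + r) ^ α * Real.log (2 + r) ^ α) := by gcongr
      _ = _ := by field_simp

/-- **Example 2.2.** For `u_t = Δu + b(x,u,Du) − c(x)|u|^{σ−1}u` in `ℝⁿ × (0,∞)` with
`|b(x,ζ,ξ)| ≤ b₀(1+|x|)^k log^s(2+|x|) |ζ|^μ |ξ|^α`, `c(x) ≥ c₀(1+|x|)^l log^m(2+|x|)`,
critical exponents `min{l−k+α, l+2} = 0`, if `σ > max{1, α+μ}` and `γ ≥ −1`
(where `γ` is defined by the three cases below), then every classical solution
stabilizes to zero uniformly on every compact subset of `ℝⁿ` as `t → ∞`. -/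
theorem example_2_2_stabilization
    (n : ℕ) (hn : 1 ≤ n)
    (b : Eucl n → ℝ → Eucl n → ℝ) (c : Eucl n → ℝ)
    (b₀ c₀ α μ σ k s l m : ℝ)
    (hb₀ : 0 < b₀) (hc₀ : 0 < c₀) (hα : 0 < α)
    (hb : ∀ (x : Eucl n) (ζ : ℝ) (ξ : Eucl n), ζ ≠ 0 →
      |b x ζ ξ| ≤ b₀ * (1 + ‖x‖) ^ k * Real.log (2 + ‖x‖) ^ s * |ζ| ^ μ * ‖ξ‖ ^ α)
    (hc : ∀ x : Eucl n, c₀ * (1 + ‖x‖) ^ l * Real.log (2 + ‖x‖) ^ m ≤ c x)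
    (hcrit : min (l - k + α) (l + 2) = 0)
    (γ : ℝ)
    (hγ₁ : l + 2 < l - k + α → γ = m)
    (hγ₂ : l + 2 = l - k + α → γ = min ((m - s) / α) m)
    (hγ₃ : l - k + α < l + 2 → γ = (m - s) / α)
    (hσ : max 1 (α + μ) < σ)
    (hγ : -1 ≤ γ)
    -- `u` is a classical solution
    (u : Eucl n → ℝ → ℝ) (du : Eucl n → ℝ → Eucl n)
    (d2u : Eucl n → ℝ → Fin n → Fin n → ℝ) (ut : Eucl n → ℝ → ℝ)
    (hdu : ∀ (x : Eucl n) (t : ℝ), 0 < t → ∀ i,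
      HasDerivAt (fun sc : ℝ => u (x + sc • EuclideanSpace.single i (1 : ℝ)) t) (du x t i) 0)
    (hd2u : ∀ (x : Eucl n) (t : ℝ), 0 < t → ∀ i j,
      HasDerivAt (fun sc : ℝ => du (x + sc • EuclideanSpace.single j (1 : ℝ)) t i) (d2u x t i j) 0)
    (hut : ∀ (x : Eucl n) (t : ℝ), 0 < t → HasDerivAt (fun τ : ℝ => u x τ) (ut x t) t)
    (hu_cont : ContinuousOn (fun q : Eucl n × ℝ => u q.1 q.2) (univ ×ˢ Ioi 0))
    (hdu_cont : ∀ i, ContinuousOn (fun q : Eucl n × ℝ => du q.1 q.2 i) (univ ×ˢ Ioi 0))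
    (hd2u_cont : ∀ i j, ContinuousOn (fun q : Eucl n × ℝ => d2u q.1 q.2 i j) (univ ×ˢ Ioi 0))
    (hut_cont : ContinuousOn (fun q : Eucl n × ℝ => ut q.1 q.2) (univ ×ˢ Ioi 0))
    -- the equation `u_t = Δu + b(x,u,Du) − c(x)|u|^{σ−1}u`
    (heq : ∀ (x : Eucl n) (t : ℝ), 0 < t →
      ut x t = (∑ i, d2u x t i i) + b x (u x t) (du x t)
        - c x * |u x t| ^ (σ - 1) * u x t) :
    ∀ K : Set (Eucl n), IsCompact K →
      Tendsto (fun t : ℝ => sSup ((fun x => |u x t|) '' K)) atTop (nhds 0) := by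
  intro K hK
  obtain ⟨κ, κ', hκ, hκ', hκC, hκB⟩ :=
    exists_critical_coefficient_bounds hb₀ hc₀ hα hcrit hγ₁ hγ₂ hγ₃ hγ
  obtain ⟨ρ, hρ⟩ := hK.isBounded.exists_norm_le
  have hlog : ∀ r : ℝ, 0 ≤ r → 0 < Real.log (2 + r) := fun r hr => Real.log_pos (by linarith)
  have hB : ∀ r : ℝ, 0 ≤ r → 0 ≤ b₀ * (1 + r) ^ k * Real.log (2 + r) ^ s := fun r hr => by
    have := hlog r hr
    positivity
  have hpow : ∀ v : ℝ, 0 < v → v ^ (σ - 1) * v = v ^ σ := fun v hv => by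
    rw [Real.rpow_sub_one hv.ne']; field_simp
  have hupper : ∀ ε : ℝ, 0 < ε → ∀ᶠ t in atTop, ∀ x, ‖x‖ ≤ ρ → u x t ≤ 3 * ε := fun ε hε =>
    eventually_forall_le_of_subsolution hα hσ hκ hκ' hB hκC hκB hdu hd2u hut hu_cont
      (fun x t ht hpos => by
        have h1 := (le_abs_self _).trans (hb x (u x t) (du x t) hpos.ne')
        have h2 := mul_le_mul_of_nonneg_right (hc x) (Real.rpow_nonneg hpos.le σ)
        have h3 := heq x t ht
        rw [abs_of_pos hpos] at h1 h3
        rw [mul_assoc, hpow _ hpos] at h3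
        linarith) hε
  have hlower : ∀ ε : ℝ, 0 < ε → ∀ᶠ t in atTop, ∀ x, ‖x‖ ≤ ρ → -u x t ≤ 3 * ε := fun ε hε =>
    eventually_forall_le_of_subsolution (u := fun x t => -u x t) (du := fun x t => -du x t)
      (d2u := fun x t i j => -d2u x t i j) (ut := fun x t => -ut x t)
      hα hσ hκ hκ' hB hκC hκB (fun x t ht i => (hdu x t ht i).neg)
      (fun x t ht i j => (hd2u x t ht i j).neg) (fun x t ht => (hut x t ht).neg) hu_cont.neg
      (fun x t ht hpos => by
        have hneg : u x t < 0 := neg_pos.1 hpos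
        have h1 := (neg_le_abs _).trans (hb x (u x t) (du x t) hneg.ne)
        have h2 := mul_le_mul_of_nonneg_right (hc x) (Real.rpow_nonneg hpos.le σ)
        have h3 := heq x t ht
        have h4 := hpow _ hpos
        rw [abs_of_neg hneg] at h1 h3
        rw [← h4] at h2 ⊢
        rw [norm_neg, Finset.sum_neg_distrib]
        linarith) hε
  rw [Metric.tendsto_nhds]
  intro ε hε
  filter_upwards [hupper (ε / 6) (by positivity), hlower (ε / 6) (by positivity)] with t h1 h2
  have h0 : 0 ≤ sSup ((fun x => |u x t|) '' K) := by
    refine Real.sSup_nonneg ?_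
    rintro _ ⟨x, -, rfl⟩
    exact abs_nonneg _
  have hle : sSup ((fun x => |u x t|) '' K) ≤ ε / 2 := by
    refine Real.sSup_le ?_ (by positivity)
    rintro _ ⟨x, hx, rfl⟩
    have := h1 x (hρ x hx)
    have := h2 x (hρ x hx)
    exact abs_le.2 ⟨by linarith, by linarith⟩
  rw [Real.dist_eq, sub_zero, abs_of_nonneg h0]
  linarith
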